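/- Suppose all k groups are interior (n_j ≥ 2 and 1 ≤ y_j ≤ n_j − 1 for all j), let u > 0, and let X be the k×m covariate matrix with rows x_1ᵀ,…,x_kᵀ. If k ≤ u or rank(X) < m, then ∫_{ℝ^m} ∫_0^∞ r^{−(u+1)} · L(r, β) dr dβ = ∞, i.e., the posterior under the joint hyper-prior dβ dr/r^{u+1} is improper. -/

import Mathlib

open MeasureTheory Real Filter Finset

/-- The Beta function `B(a,b) = ∫₀¹ v^(a-1) (1-v)^(b-1) dv`. -/
noncomputable def betaFn (a b : ℝ) : ℝ :=
  ∫ v in (0:ℝ)..1, v ^ (a - 1) * (1 - v) ^ (b - 1)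

/-- The standard logistic function `σ(t) = exp t / (1 + exp t)`. -/
noncomputable def logistic (t : ℝ) : ℝ := Real.exp t / (1 + Real.exp t)

/-- Expected random effect `p_j^E(β) = σ(x_jᵀ β)`. -/
noncomputable def pE {k m : ℕ} (x : Fin k → Fin m → ℝ) (j : Fin k) (β : Fin m → ℝ) : ℝ :=
  logistic (∑ i, x j i * β i)

/-- The Beta-Binomial likelihood
`L(r,β) = ∏ⱼ C(nⱼ,yⱼ) B(yⱼ + r pⱼᴱ, nⱼ - yⱼ + r qⱼᴱ) / B(r pⱼᴱ, r qⱼᴱ)`. -/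
noncomputable def bbL {k m : ℕ} (x : Fin k → Fin m → ℝ) (n y : Fin k → ℕ)
    (r : ℝ) (β : Fin m → ℝ) : ℝ :=
  ∏ j : Fin k,
    ((n j).choose (y j) : ℝ) *
      betaFn ((y j : ℝ) + r * pE x j β) (((n j : ℝ) - (y j : ℝ)) + r * (1 - pE x j β)) /
      betaFn (r * pE x j β) (r * (1 - pE x j β))

lemma betaFn_eq_beta {a b : ℝ} (ha : 0 < a) (hb : 0 < b) :
    betaFn a b = ProbabilityTheory.beta a b := by
  have hab : ∫ v in (0:ℝ)..1, ((v ^ (a - 1) * (1 - v) ^ (b - 1) : ℝ) : ℂ) =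
      Complex.betaIntegral a b := by
    refine intervalIntegral.integral_congr fun v hv => ?_
    rw [Set.uIcc_of_le zero_le_one] at hv
    push_cast [Complex.ofReal_cpow hv.1, Complex.ofReal_cpow (sub_nonneg.2 hv.2)]
    rfl
  rw [ProbabilityTheory.beta_eq_betaIntegralReal a b ha hb, ← hab,
    intervalIntegral.integral_ofReal, Complex.ofReal_re, betaFn]

lemma mul_Gamma_le_Gamma_nat_add {a : ℝ} (ha : 0 < a) {y : ℕ} (hy : 1 ≤ y) :
    a * Gamma a ≤ Gamma (y + a) := by
  induction y, hy using Nat.le_induction with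
  | base => rw [Nat.cast_one, add_comm, Gamma_add_one ha.ne']
  | succ y hy ih =>
    have hy' : (1 : ℝ) ≤ y := by exact_mod_cast hy
    have hΓ : 0 < Gamma (y + a) := Gamma_pos_of_pos (by positivity)
    rw [Nat.cast_succ, add_right_comm, Gamma_add_one (by positivity)]
    nlinarith

lemma Gamma_nat_add_le {r : ℝ} (hr : 0 < r) (hr1 : r ≤ 1) {n : ℕ} (hn : 1 ≤ n) :
    Gamma (n + r) ≤ n.factorial * (r * Gamma r) := by
  induction n, hn using Nat.le_induction with
  | base => simp [add_comm, Gamma_add_one hr.ne']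
  | succ n hn ih =>
    have hΓ : 0 < Gamma r := Gamma_pos_of_pos hr
    rw [Nat.cast_succ, add_right_comm, Gamma_add_one (by positivity), Nat.factorial_succ]
    push_cast
    rw [mul_assoc]
    gcongr

/-- Adding `y ≥ 1` successes and `n - y ≥ 1` failures decreases the Beta function by at most a
factor proportional to `a * b / (a + b)`, for small parameters. -/
lemma le_betaFn_div_betaFn {a b : ℝ} (ha : 0 < a) (hb : 0 < b) (hab : a + b ≤ 1) {n y : ℕ}
    (hy : 1 ≤ y) (hyn : y + 1 ≤ n) :
    a * b / (n.factorial * (a + b)) ≤ betaFn (y + a) ((n : ℝ) - y + b) / betaFn a b := by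
  have hny : (n : ℝ) - y = (n - y : ℕ) := by rw [Nat.cast_sub (by omega)]
  have hΓa := Gamma_pos_of_pos ha
  have hΓb := Gamma_pos_of_pos hb
  have hΓ := Gamma_pos_of_pos (add_pos ha hb)
  have h₁ := mul_Gamma_le_Gamma_nat_add ha hy
  have h₂ := mul_Gamma_le_Gamma_nat_add hb (y := n - y) (by omega)
  have h₃ := Gamma_nat_add_le (add_pos ha hb) hab (n := n) (by omega)
  have hpos : 0 < Gamma (n + (a + b)) := Gamma_pos_of_pos (by positivity)
  have hsum : (y + a) + ((n - y : ℕ) + b) = n + (a + b) := by rw [← hny]; ring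
  rw [hny, betaFn_eq_beta ha hb, betaFn_eq_beta (by positivity) (by positivity),
    ProbabilityTheory.beta, ProbabilityTheory.beta, hsum]
  calc a * b / (n.factorial * (a + b))
      = (a * Gamma a) * (b * Gamma b) / (n.factorial * ((a + b) * Gamma (a + b))) /
          (Gamma a * Gamma b / Gamma (a + b)) := by field_simp
    _ ≤ _ := by gcongr

lemma logistic_pos (t : ℝ) : 0 < logistic t := by unfold logistic; positivity

lemma logistic_lt_one (t : ℝ) : logistic t < 1 := by
  unfold logistic
  rw [div_lt_one (by positivity)]
  linarith

lemma continuous_logistic : Continuous logistic := by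
  unfold logistic
  exact continuous_exp.div (by fun_prop) fun t => by positivity

lemma continuous_pE {k m : ℕ} (x : Fin k → Fin m → ℝ) (j : Fin k) : Continuous (pE x j) :=
  continuous_logistic.comp (by fun_prop)

/-- The factor of the lower bound of the Beta-Binomial likelihood that depends on `β` alone. -/
noncomputable def likelihoodFactor {k m : ℕ} (x : Fin k → Fin m → ℝ) (n : Fin k → ℕ)
    (β : Fin m → ℝ) : ℝ :=
  ∏ j, pE x j β * (1 - pE x j β) / (n j).factorial

section likelihoodFactor

variable {k m : ℕ} (x : Fin k → Fin m → ℝ) (n : Fin k → ℕ)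

lemma likelihoodFactor_pos (β : Fin m → ℝ) : 0 < likelihoodFactor x n β :=
  prod_pos fun _ _ => div_pos
    (mul_pos (logistic_pos _) (sub_pos.2 (logistic_lt_one _))) (by positivity)

lemma continuous_likelihoodFactor : Continuous (likelihoodFactor x n) :=
  continuous_finsetProd _ fun j _ =>
    ((continuous_pE x j).mul (continuous_const.sub (continuous_pE x j))).div_const _

lemma periodic_likelihoodFactor {v : Fin m → ℝ} (hv : (Matrix.of x).mulVec v = 0) :
    Function.Periodic (likelihoodFactor x n) v := by
  have hp (j : Fin k) (β : Fin m → ℝ) : pE x j (β + v) = pE x j β := by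
    have hj : ∑ i, x j i * v i = 0 := congrFun hv j
    simp [pE, mul_add, sum_add_distrib, hj]
  intro β
  simp only [likelihoodFactor, hp]

lemma pow_mul_likelihoodFactor_le_bbL {y : Fin k → ℕ} (hy : ∀ j, 1 ≤ y j ∧ y j + 1 ≤ n j)
    {r : ℝ} (hr : 0 < r) (hr1 : r ≤ 1) (β : Fin m → ℝ) :
    r ^ k * likelihoodFactor x n β ≤ bbL x n y r β := by
  have hk : r ^ k = ∏ _j : Fin k, r := by simp
  rw [hk, likelihoodFactor, ← prod_mul_distrib]
  have hp (j : Fin k) : 0 < pE x j β := logistic_pos _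
  have hq (j : Fin k) : 0 < 1 - pE x j β := sub_pos.2 (logistic_lt_one _)
  refine prod_le_prod (fun j _ => ?_) fun j _ => ?_
  · have := hp j
    have := hq j
    positivity
  have hsum : r * pE x j β + r * (1 - pE x j β) = r := by ring
  have hB := le_betaFn_div_betaFn (mul_pos hr (hp j)) (mul_pos hr (hq j))
    (by rwa [hsum]) (hy j).1 (hy j).2
  rw [hsum] at hB
  have hlow : r * (pE x j β * (1 - pE x j β) / (n j).factorial) =
      r * pE x j β * (r * (1 - pE x j β)) / ((n j).factorial * r) := by field_simp
  have hlow_nonneg : 0 ≤ r * (pE x j β * (1 - pE x j β) / (n j).factorial) := by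
    have := hp j
    have := hq j
    positivity
  have hC : (1 : ℝ) ≤ (n j).choose (y j) := by
    exact_mod_cast Nat.choose_pos (by have := (hy j).2; omega)
  rw [← hlow] at hB
  rw [mul_div_assoc ((n j).choose (y j) : ℝ)]
  exact hB.trans (le_mul_of_one_le_left (hlow_nonneg.trans hB) hC)

end likelihoodFactor

/-- A continuous function with a nonzero period that is positive somewhere has infinite
integral. -/
lemma lintegral_ofReal_eq_top_of_periodic {E : Type*} [NormedAddCommGroup E] [NormedSpace ℝ E]
    [FiniteDimensional ℝ E] [MeasurableSpace E] [BorelSpace E] (μ : Measure E)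
    [μ.IsAddHaarMeasure] {f : E → ℝ} (hf : Continuous f) {v : E} (hv : v ≠ 0)
    (hper : Function.Periodic f v) {z : E} (hz : 0 < f z) :
    ∫⁻ β, ENNReal.ofReal (f β) ∂μ = ⊤ := by
  obtain ⟨c, hc, hcz⟩ := exists_between hz
  obtain ⟨ε, hε, hball⟩ := Metric.mem_nhds_iff.1 (hf.continuousAt.eventually (lt_mem_nhds hcz))
  have hv' : 0 < ‖v‖ := norm_pos_iff.2 hv
  set δ := min ε (‖v‖ / 2)
  have hδ_pos : 0 < δ := by positivity
  have hsub : ⋃ i : ℕ, Metric.ball (z + i • v) δ ⊆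
      {β | ENNReal.ofReal c ≤ ENNReal.ofReal (f β)} := by
    refine Set.iUnion_subset fun i β hβ => ENNReal.ofReal_le_ofReal ?_
    have hmem : β - i • v ∈ Metric.ball z ε := by
      rw [mem_ball_iff_norm] at hβ ⊢
      rw [sub_sub, add_comm (i • v)]
      exact hβ.trans_le (min_le_left _ _)
    rw [← hper.sub_nsmul_eq i]
    exact (hball hmem).le
  have hdisj : Pairwise (Function.onFun Disjoint fun i : ℕ => Metric.ball (z + i • v) δ) := by
    intro i j hij
    refine Metric.ball_disjoint_ball ?_
    have hdist : dist (z + i • v) (z + j • v) = |(i : ℝ) - j| * ‖v‖ := by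
      rw [dist_add_left, dist_eq_norm, ← Nat.cast_smul_eq_nsmul ℝ, ← Nat.cast_smul_eq_nsmul ℝ j,
        ← sub_smul, norm_smul, Real.norm_eq_abs]
    have hone : (1 : ℝ) ≤ |(i : ℝ) - j| := by
      exact_mod_cast Int.one_le_abs (sub_ne_zero.2 (Nat.cast_injective.ne hij) : (i : ℤ) - j ≠ 0)
    have := min_le_right ε (‖v‖ / 2)
    rw [hdist]
    nlinarith
  have htop : μ {β | ENNReal.ofReal c ≤ ENNReal.ofReal (f β)} = ⊤ := by
    refine top_le_iff.1 (le_trans (le_of_eq ?_) (measure_mono hsub))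
    rw [measure_iUnion hdisj fun i => measurableSet_ball]
    simp_rw [Measure.addHaar_ball_center μ _ δ]
    exact (ENNReal.tsum_const_eq_top_of_ne_zero (Metric.measure_ball_pos μ 0 hδ_pos).ne').symm
  have hmarkov := mul_meas_ge_le_lintegral (μ := μ)
    hf.measurable.ennreal_ofReal (ENNReal.ofReal c)
  rw [htop, ENNReal.mul_top (ENNReal.ofReal_pos.2 hc).ne'] at hmarkov
  exact top_le_iff.1 hmarkov

lemma lintegral_Ioo_rpow_eq_top {s : ℝ} (hs : s ≤ -1) :
    ∫⁻ r in Set.Ioo (0:ℝ) 1, ENNReal.ofReal (r ^ s) = ⊤ := by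
  by_contra hne
  refine hs.not_gt ((intervalIntegral.integrableOn_Ioo_rpow_iff zero_lt_one).1 ?_)
  refine (lintegral_ofReal_ne_top_iff_integrable (by fun_prop) ?_).1 hne
  filter_upwards [ae_restrict_mem measurableSet_Ioo] with r hr
  exact rpow_nonneg hr.1.le s

lemma lintegral_Ioo_rpow_pos (s : ℝ) : 0 < ∫⁻ r in Set.Ioo (0:ℝ) 1, ENNReal.ofReal (r ^ s) := by
  rw [setLIntegral_pos_iff (by fun_prop)]
  refine lt_of_lt_of_le (b := volume (Set.Ioo (0:ℝ) 1)) (by simp) (measure_mono fun r hr => ?_)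
  exact ⟨(ENNReal.ofReal_pos.2 (rpow_pos_of_pos hr.1 s)).ne', hr⟩

/-- Theorem 3 (necessity): all groups interior, fully improper hyper-prior `dβ dr/r^{u+1}`.
If `k ≤ u` or `rank(X) < m` then the posterior is improper. -/
theorem posterior_improper_fully_improper (k m : ℕ) (x : Fin k → Fin m → ℝ)
    (n y : Fin k → ℕ) (hint : ∀ j, 2 ≤ n j ∧ 1 ≤ y j ∧ y j ≤ n j - 1)
    (u : ℝ) (hu : 0 < u) (h : (k : ℝ) ≤ u ∨ (Matrix.of x).rank < m) :
    (∫⁻ β : Fin m → ℝ, ∫⁻ r in Set.Ioi (0:ℝ),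
        ENNReal.ofReal (r ^ (-(u + 1)) * bbL x n y r β)) = ⊤ := by
  have hlow : (∫⁻ β, ENNReal.ofReal (likelihoodFactor x n β)) *
      ∫⁻ r in Set.Ioo (0:ℝ) 1, ENNReal.ofReal (r ^ ((k : ℝ) - (u + 1))) ≤
      ∫⁻ β : Fin m → ℝ, ∫⁻ r in Set.Ioi (0:ℝ),
        ENNReal.ofReal (r ^ (-(u + 1)) * bbL x n y r β) := by
    rw [← lintegral_mul_const _
      (continuous_likelihoodFactor x n).measurable.ennreal_ofReal]
    refine lintegral_mono fun β => ?_
    rw [← lintegral_const_mul _ (by fun_prop)]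
    refine (setLIntegral_mono' measurableSet_Ioo fun r hr => ?_).trans
      (lintegral_mono_set Set.Ioo_subset_Ioi_self)
    rw [← ENNReal.ofReal_mul (likelihoodFactor_pos x n β).le]
    refine ENNReal.ofReal_le_ofReal ?_
    have hy (j : Fin k) : 1 ≤ y j ∧ y j + 1 ≤ n j := by
      have := hint j
      omega
    have hr_pow : r ^ ((k : ℝ) - (u + 1)) = r ^ (-(u + 1)) * r ^ k := by
      rw [← rpow_natCast, ← rpow_add hr.1, neg_add_eq_sub]
    rw [hr_pow, mul_comm, mul_assoc]
    exact mul_le_mul_of_nonneg_left (pow_mul_likelihoodFactor_le_bbL x n hy hr.1 hr.2.le β)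
      (rpow_nonneg hr.1.le _)
  refine top_le_iff.1 (le_trans (le_of_eq ?_) hlow)
  rcases h with hku | hrank
  · rw [lintegral_Ioo_rpow_eq_top (by linarith), ENNReal.mul_top]
    refine ((lintegral_pos_iff_support
      (continuous_likelihoodFactor x n).measurable.ennreal_ofReal).2 ?_).ne'
    have hsupp : Function.support (fun β => ENNReal.ofReal (likelihoodFactor x n β)) = Set.univ :=
      Set.eq_univ_of_forall fun β => (ENNReal.ofReal_pos.2 (likelihoodFactor_pos x n β)).ne'
    rw [hsupp]
    exact Measure.measure_univ_pos.2 (NeZero.ne _)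
  · obtain ⟨v, hv, hv0⟩ : ∃ v, (Matrix.of x).mulVec v = 0 ∧ v ≠ 0 := by
      have hker : LinearMap.ker (Matrix.of x).mulVecLin ≠ ⊥ := fun hbot => by
        have := LinearMap.finrank_range_of_inj (LinearMap.ker_eq_bot.1 hbot)
        rw [Module.finrank_fin_fun] at this
        exact hrank.ne this
      obtain ⟨v, hv, hv0⟩ := Submodule.exists_mem_ne_zero_of_ne_bot hker
      exact ⟨v, hv, hv0⟩
    rw [lintegral_ofReal_eq_top_of_periodic volume (continuous_likelihoodFactor x n) hv0
      (periodic_likelihoodFactor x n hv) (likelihoodFactor_pos x n 0),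
      ENNReal.top_mul (lintegral_Ioo_rpow_pos _).ne']
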